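/- Let A = C₀(0,1] = {g ∈ C([0,1],ℂ) : g(0) = 0} and let f ∈ A be the function f(x) = x. Then: (a) the closure in the uniform norm of the set {f·g : g ∈ A} equals A; (b) there is no g ∈ A with f = f·g. Consequently, in the Hilbert A-module M = A with inner product ⟨a,b⟩ = a*b, the single-element orthogonal system {f} satisfies condition (c1) (its closed A-linear span is all of M) but not condition (c2) (f itself is not of the form ∑ f·a_i). -/

import Mathlib

/-- Let `A = C₀(0,1] = {g ∈ C([0,1],ℂ) : g(0) = 0}` and `f(x) = x`.
Then (a) the uniform-norm closure of `{f·g : g ∈ A}` is all of `A`, and (b) there is no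
`g ∈ A` with `f = f·g`. Hence in the Hilbert `A`-module `M = A` (inner product
`⟨a,b⟩ = a*b`) the orthogonal system `{f}` satisfies (c1) but not (c2). -/
theorem stmt19
    (Aset : Set C(unitInterval, ℂ))
    (hA : Aset = {g : C(unitInterval, ℂ) | g 0 = 0})
    (f : C(unitInterval, ℂ)) (hf : ∀ x : unitInterval, f x = ((x : ℝ) : ℂ)) :
    closure {h : C(unitInterval, ℂ) | ∃ g ∈ Aset, h = f * g} = Aset ∧
      ¬ ∃ g ∈ Aset, f = f * g := by
  subst hA
  refine ⟨Set.Subset.antisymm ?_ ?_, ?_⟩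
  · apply closure_minimal
    · rintro h ⟨g, hg, rfl⟩
      simp only [Set.mem_ofPred_eq] at hg ⊢
      simp [hg]
    · exact isClosed_eq (continuous_eval_const (0 : unitInterval)) continuous_const
  · intro h hh
    have hh0 : h 0 = 0 := hh
    rw [Metric.mem_closure_iff]
    intro ε hε
    obtain ⟨η, hη, hcont⟩ := Metric.continuous_iff.mp h.continuous 0 (ε / 2) (by positivity)
    have hN : 0 < ‖h‖ + 1 := by positivity
    set δ : ℝ := (ε / 2) * η / (‖h‖ + 1) with hδdef
    have hδ : 0 < δ := by positivity
    have hpos : ∀ x : unitInterval, 0 < (x : ℝ) + δ := fun x => by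
      have := x.2.1
      linarith
    have hne : ∀ x : unitInterval, (((x : ℝ) + δ : ℝ) : ℂ) ≠ 0 := fun x => by
      exact_mod_cast (hpos x).ne'
    let g : C(unitInterval, ℂ) := ⟨fun x => h x / (((x : ℝ) + δ : ℝ) : ℂ), by
      apply Continuous.div h.continuous _ hne
      fun_prop⟩
    have hgx : ∀ x, g x = h x / (((x : ℝ) + δ : ℝ) : ℂ) := fun x => rfl
    refine ⟨f * g, ⟨g, ?_, rfl⟩, ?_⟩
    · simp [hgx, hh0]
    · refine lt_of_le_of_lt ((ContinuousMap.dist_le (by positivity : 0 ≤ ε / 2)).mpr ?_)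
        (half_lt_self hε)
      intro x
      have key : h x - (f * g) x = h x * ((δ / ((x : ℝ) + δ) : ℝ) : ℂ) := by
        have := hne x
        rw [ContinuousMap.mul_apply, hf, hgx]
        push_cast at this ⊢
        field_simp
        ring
      have hx0 := x.2.1
      rw [dist_eq_norm, key, norm_mul, Complex.norm_real, Real.norm_of_nonneg
        (div_nonneg hδ.le (hpos x).le)]
      by_cases hx : (x : ℝ) < η
      · have h1 : ‖h x‖ < ε / 2 := by
          have := hcont x (by
            rw [Subtype.dist_eq, Real.dist_eq]
            simpa [abs_of_nonneg hx0] using hx)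
          simpa [hh0] using this
        have h2 : δ / ((x : ℝ) + δ) ≤ 1 := by
          rw [div_le_one (hpos x)]
          linarith
        calc _ ≤ ‖h x‖ * 1 := by gcongr
          _ ≤ _ := by linarith
      · push Not at hx
        have h1 : ‖h x‖ ≤ ‖h‖ + 1 := (h.norm_coe_le_norm x).trans (by linarith)
        have h2 : δ / ((x : ℝ) + δ) ≤ δ / η := by
          gcongr
          linarith
        calc _ ≤ (‖h‖ + 1) * (δ / η) := by
              gcongr
          _ = ε / 2 := by
            rw [hδdef]
            field_simp
  · rintro ⟨g, hg, hfg⟩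
    have hg0 : g 0 = 0 := hg
    obtain ⟨η, hη, hcont⟩ := Metric.continuous_iff.mp g.continuous 0 1 one_pos
    have hm : 0 < min (η / 2) 1 := by positivity
    let x : unitInterval := ⟨min (η / 2) 1, hm.le, min_le_right _ _⟩
    have hx : (x : ℝ) = min (η / 2) 1 := rfl
    have h1 := hcont x (by
      rw [Subtype.dist_eq, Real.dist_eq, hx]
      have : min (η / 2) 1 ≤ η / 2 := min_le_left _ _
      simp only [Set.Icc.coe_zero, sub_zero]
      rw [abs_of_pos hm]
      linarith)
    have h2 := DFunLike.congr_fun hfg x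
    rw [ContinuousMap.mul_apply, hf] at h2
    have h3 : ((x : ℝ) : ℂ) ≠ 0 := by
      rw [hx]
      exact_mod_cast hm.ne'
    have h4 : g x = 1 := by
      apply mul_left_cancel₀ h3
      rw [← h2, mul_one]
    rw [hg0, h4] at h1
    simp at h1
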